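/- arXiv:2502.10926 — 2 statements merged into one kernel-verified Lean document; each statement's English description precedes it below -/
import Mathlib

section
/- Let k be a field and Q_1, …, Q_s monic polynomials over k of degrees q_1, …, q_s ≥ 1. The generalized companion matrix C(Q_1, …, Q_s) is nilpotent if and only if Q_j = X^{q_j} for every j = 1, …, s. In particular, the set of generalized companion matrices with fixed block degrees (q_1, …, q_s) contains exactly one nilpotent matrix. -/
open Finset in
/-- The block of position `i` among consecutive blocks of sizes `q 0, …, q (s-1)`:
the number of blocks completely contained in `{0, …, i}`. -/
def blockOf (q : ℕ → ℕ) (s i : ℕ) : ℕ :=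
  ((Finset.range s).filter fun b => ∑ j ∈ Finset.range (b + 1), q j ≤ i).card

/-- The companion matrix of a monic polynomial `P` of degree `m` (as an `m × m` matrix,
0-indexed): entries `1` on the subdiagonal, `-(coeff i)` in the last column, `0` elsewhere. -/
def companionMatrix {k : Type*} [Field k] (m : ℕ) (P : Polynomial k) :
    Matrix (Fin m) (Fin m) k :=
  Matrix.of fun i j =>
    if (j : ℕ) = m - 1 then -P.coeff i
    else if (i : ℕ) = (j : ℕ) + 1 then 1 else 0

/-- The generalized companion matrix `C(Q 0, …, Q (s-1))` of size `m = q 0 + ⋯ + q (s-1)`: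
diagonal blocks are the companion matrices `B(Q b)` of sizes `q b`, all subdiagonal entries
(also those between consecutive blocks) are `1`, and all other entries are `0`. -/
def genCompanion {k : Type*} [Field k] (s : ℕ) (q : ℕ → ℕ) (Q : ℕ → Polynomial k)
    (m : ℕ) : Matrix (Fin m) (Fin m) k :=
  Matrix.of fun i j =>
    let bi := blockOf q s i
    let bj := blockOf q s j
    let off := ∑ t ∈ Finset.range bj, q t
    if bi = bj ∧ (j : ℕ) = off + q bj - 1 then -(Q bj).coeff ((i : ℕ) - off)
    else if (i : ℕ) = (j : ℕ) + 1 then 1 else 0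


open Polynomial

lemma blockOf_eq {q : ℕ → ℕ} {s b i : ℕ} (hb : b ≤ s) (hle : ∑ t ∈ Finset.range b, q t ≤ i)
    (hlt : b < s → i < ∑ t ∈ Finset.range (b + 1), q t) : blockOf q s i = b := by
  have hmono : Monotone fun n => ∑ t ∈ Finset.range n, q t := fun a c hac =>
    Finset.sum_le_sum_of_subset (Finset.range_mono hac)
  have hfilter : ((Finset.range s).filter fun c => ∑ t ∈ Finset.range (c + 1), q t ≤ i)
      = Finset.range b := by
    ext c
    simp only [Finset.mem_filter, Finset.mem_range]
    constructor
    · rintro ⟨hcs, hci⟩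
      by_contra! hbc
      have h₁ := hlt (by omega)
      have h₂ := hmono (show b + 1 ≤ c + 1 by omega)
      simp only at h₂
      omega
    · intro hcb
      have h₂ := hmono (show c + 1 ≤ b by omega)
      simp only at h₂
      exact ⟨by omega, by omega⟩
  rw [blockOf, hfilter, Finset.card_range]

lemma exists_block {q : ℕ → ℕ} {s i : ℕ} (hi : i < ∑ t ∈ Finset.range s, q t) :
    ∃ b < s, ∑ t ∈ Finset.range b, q t ≤ i ∧ i < ∑ t ∈ Finset.range (b + 1), q t := by
  induction s with
  | zero => simp at hi
  | succ s ih =>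
    by_cases h : i < ∑ t ∈ Finset.range s, q t
    · obtain ⟨b, hb, hbi⟩ := ih h
      exact ⟨b, by omega, hbi⟩
    · exact ⟨s, by omega, by omega, hi⟩

lemma blockOf_spec {q : ℕ → ℕ} {s i : ℕ} (hi : i < ∑ t ∈ Finset.range s, q t) :
    blockOf q s i < s ∧ ∑ t ∈ Finset.range (blockOf q s i), q t ≤ i ∧
      i < ∑ t ∈ Finset.range (blockOf q s i + 1), q t := by
  obtain ⟨b, hb, hle, hlt⟩ := exists_block hi
  rw [blockOf_eq hb.le hle fun _ => hlt]
  exact ⟨hb, hle, hlt⟩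

lemma blockOf_sum_range {q : ℕ → ℕ} {s b : ℕ} (hq : ∀ j < s, 1 ≤ q j) (hb : b ≤ s) :
    blockOf q s (∑ t ∈ Finset.range b, q t) = b :=
  blockOf_eq hb le_rfl fun h => by
    have := hq b h
    rw [Finset.sum_range_succ]
    omega

lemma filter_blockOf_eq {q : ℕ → ℕ} {s b : ℕ} (hb : b < s) :
    ((Finset.range (∑ t ∈ Finset.range s, q t)).filter fun i => blockOf q s i = b)
      = Finset.Ico (∑ t ∈ Finset.range b, q t) (∑ t ∈ Finset.range (b + 1), q t) := by
  ext i
  simp only [Finset.mem_filter, Finset.mem_range, Finset.mem_Ico]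
  constructor
  · rintro ⟨hi, rfl⟩
    exact (blockOf_spec hi).2
  · rintro ⟨hle, hlt⟩
    have hmono : ∑ t ∈ Finset.range (b + 1), q t ≤ ∑ t ∈ Finset.range s, q t :=
      Finset.sum_le_sum_of_subset (Finset.range_mono hb)
    exact ⟨by omega, blockOf_eq hb.le hle fun _ => hlt⟩

section Shift

variable {k : Type*} [Field k]

/-- The entry of `genCompanion` at natural number indices. -/
def genCompanionEntry (s : ℕ) (q : ℕ → ℕ) (Q : ℕ → k[X]) (i j : ℕ) : k :=
  if blockOf q s i = blockOf q s j ∧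
      j = ∑ t ∈ Finset.range (blockOf q s j), q t + q (blockOf q s j) - 1 then
    -(Q (blockOf q s j)).coeff (i - ∑ t ∈ Finset.range (blockOf q s j), q t)
  else if i = j + 1 then 1 else 0

lemma genCompanion_apply (s : ℕ) (q : ℕ → ℕ) (Q : ℕ → k[X]) (m : ℕ) (i j : Fin m) :
    genCompanion s q Q m i j = genCompanionEntry s q Q i j := rfl

/-- The product of the polynomials of the blocks preceding that of `i`, times the power of `X`
given by the position of `i` in its block. These polynomials form a basis of
`k[X] / (∏ Q b)` in which multiplication by `X` has matrix `genCompanion s q Q`. -/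
noncomputable def blockBasis (s : ℕ) (q : ℕ → ℕ) (Q : ℕ → k[X]) (i : ℕ) : k[X] :=
  (∏ t ∈ Finset.range (blockOf q s i), Q t) *
    X ^ (i - ∑ t ∈ Finset.range (blockOf q s i), q t)

lemma blockBasis_sum_range {s : ℕ} {q : ℕ → ℕ} (Q : ℕ → k[X]) {b : ℕ}
    (hq : ∀ j < s, 1 ≤ q j) (hb : b ≤ s) :
    blockBasis s q Q (∑ t ∈ Finset.range b, q t) = ∏ t ∈ Finset.range b, Q t := by
  simp [blockBasis, blockOf_sum_range hq hb]

lemma blockBasis_add {s : ℕ} {q : ℕ → ℕ} (Q : ℕ → k[X]) {b t : ℕ} (hb : b < s) (ht : t < q b) :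
    blockBasis s q Q (∑ t ∈ Finset.range b, q t + t)
      = (∏ t ∈ Finset.range b, Q t) * X ^ t := by
  have h : blockOf q s (∑ t ∈ Finset.range b, q t + t) = b :=
    blockOf_eq hb.le (by omega) fun _ => by rw [Finset.sum_range_succ]; omega
  simp [blockBasis, h]

/-- Multiplication by `X` acts on the `blockBasis` through `genCompanion`, up to the product of
all the block polynomials, which is `blockBasis` at the first index out of range. -/
lemma sum_blockBasis_mul_entry {s : ℕ} {q : ℕ → ℕ} {Q : ℕ → k[X]} (hq : ∀ j < s, 1 ≤ q j)
    (hmonic : ∀ j < s, (Q j).Monic) (hdeg : ∀ j < s, (Q j).natDegree = q j) {j : ℕ}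
    (hj : j < ∑ t ∈ Finset.range s, q t) :
    ∑ i ∈ Finset.range (∑ t ∈ Finset.range s, q t + 1),
        blockBasis s q Q i * (if i < ∑ t ∈ Finset.range s, q t then
          C (genCompanionEntry s q Q i j) else if i = j + 1 then 1 else 0)
      = X * blockBasis s q Q j := by
  set m := ∑ t ∈ Finset.range s, q t with hm
  obtain ⟨b, hb, hle, hlt⟩ := exists_block hj
  have hbj : blockOf q s j = b := blockOf_eq hb.le hle fun _ => hlt
  have hqb := hq b hb
  obtain ⟨t, rfl⟩ := Nat.exists_eq_add_of_le hle
  rw [Finset.sum_range_succ] at hlt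
  have htb : t < q b := by omega
  have hshift : ∑ i ∈ Finset.range (m + 1), blockBasis s q Q i *
      (if i = ∑ t ∈ Finset.range b, q t + t + 1 then 1 else 0)
      = blockBasis s q Q (∑ t ∈ Finset.range b, q t + t + 1) := by
    simp only [mul_ite, mul_one, mul_zero, Finset.sum_ite_eq', Finset.mem_range]
    rw [if_pos (by omega)]
  rw [blockBasis_add Q hb htb]
  by_cases hlast : t + 1 < q b
  · rw [Finset.sum_congr rfl fun i _ => ?_, hshift, add_assoc, blockBasis_add Q hb hlast]
    · ring
    · congr 1
      have hnot : ¬(blockOf q s i = b ∧ ∑ t ∈ Finset.range b, q t + t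
          = ∑ t ∈ Finset.range b, q t + q b - 1) := by omega
      rw [genCompanionEntry, hbj, if_neg hnot]
      split_ifs <;> simp
  · have hnext : ∑ t ∈ Finset.range b, q t + t + 1 = ∑ t ∈ Finset.range (b + 1), q t := by
      rw [Finset.sum_range_succ]; omega
    have hblock : ∑ i ∈ Finset.range m, blockBasis s q Q i *
        (if blockOf q s i = b then C (-(Q b).coeff (i - ∑ t ∈ Finset.range b, q t)) else 0)
        = (∏ t ∈ Finset.range b, Q t) * (X ^ q b - Q b) := by
      simp only [mul_ite, mul_zero]
      rw [← Finset.sum_filter, hm, filter_blockOf_eq hb, Finset.sum_Ico_eq_sum_range,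
        Finset.sum_range_succ, Nat.add_sub_cancel_left]
      conv_rhs => rw [(hmonic b hb).as_sum, hdeg b hb]
      rw [sub_add_cancel_left, ← Finset.sum_neg_distrib, Finset.mul_sum]
      refine Finset.sum_congr rfl fun i hi => ?_
      rw [blockBasis_add Q hb (Finset.mem_range.1 hi), Nat.add_sub_cancel_left, C_neg]
      ring
    have hsplit : ∀ i ∈ Finset.range (m + 1), blockBasis s q Q i *
        (if i < m then C (genCompanionEntry s q Q i (∑ t ∈ Finset.range b, q t + t))
          else if i = ∑ t ∈ Finset.range b, q t + t + 1 then 1 else 0)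
        = blockBasis s q Q i * (if i < m then
            (if blockOf q s i = b then C (-(Q b).coeff (i - ∑ t ∈ Finset.range b, q t)) else 0)
            else 0)
          + blockBasis s q Q i *
            (if i = ∑ t ∈ Finset.range b, q t + t + 1 then 1 else 0) := by
      intro i _
      rw [← mul_add]
      congr 1
      by_cases him : i < m
      · rw [if_pos him, if_pos him, genCompanionEntry, hbj]
        by_cases hib : blockOf q s i = b
        · have hne : i ≠ ∑ t ∈ Finset.range b, q t + t + 1 := by
            rintro rfl
            rw [hnext, blockOf_sum_range hq hb] at hib
            omega
          rw [if_pos ⟨hib, by omega⟩, if_pos hib, if_neg hne, add_zero]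
        · rw [if_neg fun h => hib h.1, if_neg hib]
          split_ifs <;> simp
      · rw [if_neg him, if_neg him, zero_add]
    rw [Finset.sum_congr rfl hsplit, Finset.sum_add_distrib, hshift, hnext,
      blockBasis_sum_range Q hq hb, Finset.sum_range_succ, if_neg (lt_irrefl m), mul_zero, add_zero,
      Finset.sum_congr rfl fun i hi => by rw [if_pos (Finset.mem_range.1 hi)], hblock,
      Finset.prod_range_succ]
    have : q b = t + 1 := by omega
    rw [this]
    ring

lemma vecMul_pow_of_vecMul_eq_smul {n R : Type*} [Fintype n] [DecidableEq n] [CommRing R]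
    {M : Matrix n n R} {w : n → R} {a : R} (h : Matrix.vecMul w M = a • w) (N : ℕ) :
    Matrix.vecMul w (M ^ N) = a ^ N • w := by
  induction N with
  | zero => simp
  | succ N ih =>
    rw [pow_succ, ← Matrix.vecMul_vecMul, ih, Matrix.smul_vecMul, h, smul_smul, pow_succ]

lemma vecMul_map_genCompanion {s : ℕ} {q : ℕ → ℕ} {Q : ℕ → k[X]} (hq : ∀ j < s, 1 ≤ q j)
    (hmonic : ∀ j < s, (Q j).Monic) (hdeg : ∀ j < s, (Q j).natDegree = q j) {m : ℕ}
    (hm : m = ∑ t ∈ Finset.range s, q t) :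
    Matrix.vecMul
        (fun i : Fin m => AdjoinRoot.mk (∏ t ∈ Finset.range s, Q t) (blockBasis s q Q i))
        ((genCompanion s q Q m).map (AdjoinRoot.of (∏ t ∈ Finset.range s, Q t)))
      = AdjoinRoot.root (∏ t ∈ Finset.range s, Q t) •
        fun i : Fin m => AdjoinRoot.mk (∏ t ∈ Finset.range s, Q t) (blockBasis s q Q i) := by
  ext j
  have hj : (j : ℕ) < ∑ t ∈ Finset.range s, q t := hm ▸ j.2
  have h := congrArg (AdjoinRoot.mk (∏ t ∈ Finset.range s, Q t))
    (sum_blockBasis_mul_entry hq hmonic hdeg hj)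
  rw [Finset.sum_range_succ, blockBasis_sum_range Q hq le_rfl, map_add, map_mul, AdjoinRoot.mk_self,
    zero_mul, add_zero, map_mul, AdjoinRoot.mk_X, map_sum, ← hm] at h
  rw [Pi.smul_apply, smul_eq_mul, ← h, Finset.sum_range, Matrix.vecMul, dotProduct]
  refine Finset.sum_congr rfl fun i _ => ?_
  rw [if_pos i.2, map_mul, AdjoinRoot.mk_C, Matrix.map_apply, genCompanion_apply]

lemma eq_X_pow_of_isNilpotent_genCompanion {s : ℕ} {q : ℕ → ℕ} {Q : ℕ → k[X]}
    (hq : ∀ j < s, 1 ≤ q j) (hmonic : ∀ j < s, (Q j).Monic)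
    (hdeg : ∀ j < s, (Q j).natDegree = q j) {m : ℕ} (hm : m = ∑ t ∈ Finset.range s, q t)
    (hnil : IsNilpotent (genCompanion s q Q m)) : ∀ j < s, Q j = X ^ q j := by
  intro j hj
  obtain ⟨N, hN⟩ := hnil
  have hm0 : 0 < m := by
    have := Finset.single_le_sum (f := q) (fun i _ => Nat.zero_le _) (Finset.mem_range.2 hj)
    have := hq j hj
    omega
  have h := congrFun
    (vecMul_pow_of_vecMul_eq_smul (vecMul_map_genCompanion hq hmonic hdeg hm) N) ⟨0, hm0⟩
  have hone : blockBasis s q Q 0 = 1 := by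
    simpa using blockBasis_sum_range Q hq (Nat.zero_le s)
  rw [← Matrix.map_pow, hN, Matrix.map_zero _ (map_zero _), Matrix.vecMul_zero, Pi.smul_apply, hone,
    map_one, smul_eq_mul, mul_one, ← AdjoinRoot.mk_X, ← map_pow, Pi.zero_apply, eq_comm,
    AdjoinRoot.mk_eq_zero] at h
  obtain ⟨d, -, hd⟩ := (dvd_prime_pow prime_X N).1
    ((Finset.dvd_prod_of_mem Q (Finset.mem_range.2 hj)).trans h)
  have hQ := eq_of_monic_of_associated (hmonic j hj) (monic_X_pow d) hd
  rw [← hdeg j hj, hQ, natDegree_X_pow]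

lemma genCompanion_congr {s : ℕ} {q : ℕ → ℕ} {Q Q' : ℕ → k[X]} {m : ℕ}
    (hm : m = ∑ t ∈ Finset.range s, q t) (h : ∀ j < s, Q j = Q' j) :
    genCompanion s q Q m = genCompanion s q Q' m := by
  ext i j
  rw [genCompanion_apply, genCompanion_apply, genCompanionEntry, genCompanionEntry,
    h _ (blockOf_spec (j.2.trans_eq hm)).1]

lemma isNilpotent_of_eq_zero_of_ne_succ {m : ℕ} {M : Matrix (Fin m) (Fin m) k}
    (h : ∀ i j : Fin m, (i : ℕ) ≠ j + 1 → M i j = 0) : IsNilpotent M := by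
  have hpow : ∀ (N : ℕ) (i j : Fin m), (i : ℕ) ≠ j + N → (M ^ N) i j = 0 := by
    intro N
    induction N with
    | zero =>
      intro i j hij
      rw [pow_zero, Matrix.one_apply_ne fun h => hij (by simp [h])]
    | succ N ih =>
      intro i j hij
      rw [pow_succ, Matrix.mul_apply]
      refine Finset.sum_eq_zero fun l _ => ?_
      by_cases hl : (l : ℕ) = j + 1
      · rw [ih i l (by omega), zero_mul]
      · rw [h l j hl, mul_zero]
  exact ⟨m, by ext i j; exact hpow m i j (by omega)⟩

lemma isNilpotent_genCompanion {s : ℕ} {q : ℕ → ℕ} {Q : ℕ → k[X]} {m : ℕ}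
    (hm : m = ∑ t ∈ Finset.range s, q t) (h : ∀ j < s, Q j = X ^ q j) :
    IsNilpotent (genCompanion s q Q m) := by
  refine isNilpotent_of_eq_zero_of_ne_succ fun i j hij => ?_
  obtain ⟨hb, -, -⟩ := blockOf_spec (j.2.trans_eq hm)
  obtain ⟨-, hle, hlt⟩ := blockOf_spec (i.2.trans_eq hm)
  rw [genCompanion_apply, genCompanionEntry, if_neg hij]
  split_ifs with hblock
  · rw [hblock.1] at hle hlt
    rw [Finset.sum_range_succ] at hlt
    rw [h _ hb, coeff_X_pow, if_neg (by omega), neg_zero]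
  · rfl

end Shift

/-- the generalized companion matrix `C(Q 0, …, Q (s-1))` is nilpotent iff
`Q j = X ^ (q j)` for every `j < s`; in particular, among all generalized companion
matrices with the fixed block degrees `q 0, …, q (s-1)` there is exactly one nilpotent one. -/
theorem stmt3 {k : Type*} [Field k] (s : ℕ)
    (q : ℕ → ℕ) (hq : ∀ j < s, 1 ≤ q j)
    (Q : ℕ → Polynomial k) (hQmonic : ∀ j < s, (Q j).Monic)
    (hQdeg : ∀ j < s, (Q j).natDegree = q j)
    (m : ℕ) (hm : m = ∑ j ∈ Finset.range s, q j) :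
    (IsNilpotent (genCompanion s q Q m) ↔ ∀ j < s, Q j = Polynomial.X ^ q j) ∧
    ∃! C : Matrix (Fin m) (Fin m) k,
      (∃ Q' : ℕ → Polynomial k, (∀ j < s, (Q' j).Monic ∧ (Q' j).natDegree = q j) ∧
        C = genCompanion s q Q' m) ∧ IsNilpotent C := by
  have hiff : ∀ Q' : ℕ → Polynomial k, (∀ j < s, (Q' j).Monic ∧ (Q' j).natDegree = q j) →
      (IsNilpotent (genCompanion s q Q' m) ↔ ∀ j < s, Q' j = Polynomial.X ^ q j) :=
    fun Q' hQ' => ⟨eq_X_pow_of_isNilpotent_genCompanion hq (fun j hj => (hQ' j hj).1)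
      (fun j hj => (hQ' j hj).2) hm, isNilpotent_genCompanion hm⟩
  refine ⟨hiff Q fun j hj => ⟨hQmonic j hj, hQdeg j hj⟩,
    genCompanion s q (fun j => Polynomial.X ^ q j) m,
    ⟨⟨_, fun j _ => ⟨Polynomial.monic_X_pow _, Polynomial.natDegree_X_pow _⟩, rfl⟩,
      isNilpotent_genCompanion hm fun _ _ => rfl⟩, ?_⟩
  rintro _ ⟨⟨Q', hQ', rfl⟩, hnil⟩
  exact genCompanion_congr hm ((hiff Q' hQ').1 hnil)
end

section
/- Let k be a field and p = (p_1 ≥ p_2 ≥ … ≥ p_r ≥ 1) a partition of n with s distinct parts. Let j_1 < j_2 < … < j_{s−1} be the indices i < r with p_i ≠ p_{i+1}, and set j_0 = 0, j_s = r; put q_i = p_{j_i} − p_{j_i + 1} for 1 ≤ i ≤ s−1 and q_s = p_r. For monic polynomials Q_1, …, Q_s over k with deg Q_i = q_i, let A(Q_1, …, Q_s) be the block-diagonal matrix with blocks D_1, …, D_r, where D_i = C(Q_k, Q_{k+1}, …, Q_s) for j_{k−1} < i ≤ j_k. Then: (a) A(Q_1, …, Q_s) is similar over k to the rational normal form R(P_1,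 …, P_r), where P_i = Q_k·Q_{k+1}⋯Q_s for j_{k−1} < i ≤ j_k; (b) the assignment (Q_1, …, Q_s) ↦ (P_1, …, P_r) is a bijection from s-tuples of monic polynomials of degrees (q_1, …, q_s) onto the r-tuples of monic polynomials (P_1, …, P_r) with deg P_i = p_i for all i and P_{i+1} dividing P_i for 1 ≤ i < r. Consequently, the map sending a matrix to its rational normal form induces a bijection between the set A(p) = {A(Q_1, …, Q_s)} and the set R(p) of rational normal forms with block sizes p_1, …, p_r. -/
/-- The block diagonal matrix of size `n` with diagonal blocks `D 0, …, D (r-1)` of sizes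
`p 0, …, p (r-1)`. -/
def blockDiagMat {k : Type*} [Field k] (r : ℕ) (p : ℕ → ℕ)
    (D : (b : ℕ) → Matrix (Fin (p b)) (Fin (p b)) k) (n : ℕ) :
    Matrix (Fin n) (Fin n) k :=
  Matrix.of fun i j =>
    let bj := blockOf p r j
    let off := ∑ t ∈ Finset.range bj, p t
    if h : blockOf p r i = bj ∧ (i : ℕ) - off < p bj ∧ (j : ℕ) - off < p bj then
      D bj ⟨(i : ℕ) - off, h.2.1⟩ ⟨(j : ℕ) - off, h.2.2⟩
    else 0

/-- The rational normal form `R(P 0, …, P (r-1))`: the block diagonal matrix whose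
diagonal blocks are the companion matrices `B(P b)` of sizes `p b`, all other entries `0`. -/
def ratNormalForm {k : Type*} [Field k] (r : ℕ) (p : ℕ → ℕ) (P : ℕ → Polynomial k)
    (n : ℕ) : Matrix (Fin n) (Fin n) k :=
  Matrix.of fun i j =>
    let bi := blockOf p r i
    let bj := blockOf p r j
    let off := ∑ t ∈ Finset.range bj, p t
    if bi = bj then
      (if (j : ℕ) = off + p bj - 1 then -(P bj).coeff ((i : ℕ) - off)
       else if (i : ℕ) = (j : ℕ) + 1 then 1 else 0)
    else 0

/-- For a block index `i`, the number `k(i)` (0-indexed) such that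
`j (k(i) - 1) < i ≤ j k(i)`: the number of jump indices `< i`. -/
def kOf (jj : ℕ → ℕ) (s i : ℕ) : ℕ :=
  ((Finset.range (s - 1)).filter fun t => jj t < i).card

open Polynomial Finset

lemma blockOf_sum_add (q : ℕ → ℕ) {s b x : ℕ} (hb : b < s) (hx : x < q b) :
    blockOf q s (∑ t ∈ range b, q t + x) = b := by
  have h : ((range s).filter fun c => ∑ j ∈ range (c + 1), q j ≤ ∑ t ∈ range b, q t + x)
      = range b := by
    ext c
    simp only [mem_filter, mem_range]
    constructor
    · rintro ⟨-, hc⟩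
      by_contra hbc
      have hle : ∑ j ∈ range (b + 1), q j ≤ ∑ j ∈ range (c + 1), q j :=
        sum_le_sum_of_subset (range_mono (by omega))
      rw [sum_range_succ] at hle
      omega
    · intro hc
      have hle : ∑ j ∈ range (c + 1), q j ≤ ∑ j ∈ range b, q j :=
        sum_le_sum_of_subset (range_mono (by omega))
      exact ⟨by omega, by omega⟩
  rw [blockOf, h, card_range]

lemma blockOf_of_sum_le (q : ℕ → ℕ) {s i : ℕ} (hi : ∑ t ∈ range s, q t ≤ i) :
    blockOf q s i = s := by
  have h : ((range s).filter fun c => ∑ j ∈ range (c + 1), q j ≤ i) = range s := by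
    refine filter_true_of_mem fun c hc => le_trans ?_ hi
    exact sum_le_sum_of_subset (range_mono (by simpa using hc))
  rw [blockOf, h, card_range]

lemma exists_eq_sum_add (q : ℕ → ℕ) {s i : ℕ} (hi : i < ∑ t ∈ range s, q t) :
    ∃ b < s, ∃ x < q b, i = ∑ t ∈ range b, q t + x := by
  induction s with
  | zero => simp at hi
  | succ s ih =>
    by_cases h : i < ∑ t ∈ range s, q t
    · obtain ⟨b, hb, hx⟩ := ih h
      exact ⟨b, by omega, hx⟩
    · rw [sum_range_succ] at hi
      exact ⟨s, by omega, i - ∑ t ∈ range s, q t, by omega, by omega⟩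

section Blocks

variable {k : Type*} [Field k]

/-- The equivalence between pairs (block, position inside the block) and positions. -/
def blockEquiv {r n : ℕ} {p : ℕ → ℕ} (hsum : ∑ i ∈ range r, p i = n) :
    (b : Fin r) × Fin (p b) ≃ Fin n :=
  finSigmaFinEquiv.trans (finCongr ((Fin.sum_univ_eq_sum_range p r).trans hsum))

lemma blockEquiv_val {r n : ℕ} {p : ℕ → ℕ} (hsum : ∑ i ∈ range r, p i = n)
    (b : Fin r) (x : Fin (p b)) :
    (blockEquiv hsum ⟨b, x⟩ : ℕ) = ∑ t ∈ range b, p t + x := by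
  simp [blockEquiv, ← Fin.sum_univ_eq_sum_range]

/-- Assembling diagonal blocks into a block diagonal matrix, as a ring homomorphism. -/
def blockDiagHom (k : Type*) [Field k] {r n : ℕ} {p : ℕ → ℕ} (hsum : ∑ i ∈ range r, p i = n) :
    ((b : Fin r) → Matrix (Fin (p b)) (Fin (p b)) k) →+* Matrix (Fin n) (Fin n) k :=
  (Matrix.reindexAlgEquiv k k (blockEquiv hsum)).toRingEquiv.toRingHom.comp
    (Matrix.blockDiagonal'RingHom (fun b : Fin r => Fin (p b)) k)

lemma blockDiagHom_apply {r n : ℕ} {p : ℕ → ℕ} (hsum : ∑ i ∈ range r, p i = n)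
    (D : (b : Fin r) → Matrix (Fin (p b)) (Fin (p b)) k) (i j : (b : Fin r) × Fin (p b)) :
    blockDiagHom k hsum D (blockEquiv hsum i) (blockEquiv hsum j)
      = Matrix.blockDiagonal' D i j := by
  simp [blockDiagHom]

lemma blockDiagMat_eq {r n : ℕ} {p : ℕ → ℕ} (hsum : ∑ i ∈ range r, p i = n)
    (D : (b : ℕ) → Matrix (Fin (p b)) (Fin (p b)) k) :
    blockDiagMat r p D n = blockDiagHom k hsum fun b => D b := by
  ext i j
  obtain ⟨⟨b, x⟩, rfl⟩ := (blockEquiv hsum).surjective i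
  obtain ⟨⟨c, y⟩, rfl⟩ := (blockEquiv hsum).surjective j
  rw [blockDiagHom_apply]
  have hx : blockOf p r (blockEquiv hsum ⟨b, x⟩) = b := by
    rw [blockEquiv_val, blockOf_sum_add p b.2 x.2]
  have hy : blockOf p r (blockEquiv hsum ⟨c, y⟩) = c := by
    rw [blockEquiv_val, blockOf_sum_add p c.2 y.2]
  simp only [blockDiagMat, Matrix.of_apply, hx]
  suffices key : ∀ c' : ℕ, c' = c → (if h : (b : ℕ) = c' ∧
      (blockEquiv hsum ⟨b, x⟩ : ℕ) - ∑ t ∈ range c', p t < p c' ∧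
      (blockEquiv hsum ⟨c, y⟩ : ℕ) - ∑ t ∈ range c', p t < p c'
      then D c' ⟨_, h.2.1⟩ ⟨_, h.2.2⟩ else 0)
        = Matrix.blockDiagonal' (fun b : Fin r => D b) ⟨b, x⟩ ⟨c, y⟩ from key _ hy
  rintro _ rfl
  by_cases h : b = c
  · subst h
    simp [blockEquiv_val]
  · rw [Matrix.blockDiagonal'_apply_ne _ _ _ h, dif_neg]
    exact fun h' => h (Fin.ext h'.1)

lemma ratNormalForm_eq {r n : ℕ} {p : ℕ → ℕ} (hsum : ∑ i ∈ range r, p i = n)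
    (P : ℕ → k[X]) :
    ratNormalForm r p P n = blockDiagHom k hsum fun b => companionMatrix (p b) (P b) := by
  ext i j
  obtain ⟨⟨b, x⟩, rfl⟩ := (blockEquiv hsum).surjective i
  obtain ⟨⟨c, y⟩, rfl⟩ := (blockEquiv hsum).surjective j
  rw [blockDiagHom_apply]
  simp only [ratNormalForm, Matrix.of_apply, blockEquiv_val, blockOf_sum_add p b.2 x.2,
    blockOf_sum_add p c.2 y.2]
  by_cases h : b = c
  · subst h
    have h₁ : (∑ t ∈ range b, p t + (y : ℕ) = ∑ t ∈ range b, p t + p b - 1)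
        ↔ (y : ℕ) = p b - 1 := by have := y.2; omega
    have h₂ : (∑ t ∈ range b, p t + (x : ℕ) = ∑ t ∈ range b, p t + (y : ℕ) + 1)
        ↔ (x : ℕ) = y + 1 := by omega
    simp [companionMatrix, h₁, h₂]
  · rw [Matrix.blockDiagonal'_apply_ne _ _ _ h, if_neg]
    exact fun h' => h (Fin.ext h')

lemma exists_conj_blockDiagHom {r n : ℕ} {p : ℕ → ℕ} (hsum : ∑ i ∈ range r, p i = n)
    (D E : (b : Fin r) → Matrix (Fin (p b)) (Fin (p b)) k)
    (h : ∀ b : Fin r, ∃ T : (Matrix (Fin (p b)) (Fin (p b)) k)ˣ, T⁻¹.1 * D b * T.1 = E b) :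
    ∃ T : (Matrix (Fin n) (Fin n) k)ˣ,
      T⁻¹.1 * blockDiagHom k hsum D * T.1 = blockDiagHom k hsum E := by
  choose T hT using h
  refine ⟨Units.map (blockDiagHom k hsum).toMonoidHom (MulEquiv.piUnits.symm T), ?_⟩
  rw [← map_inv]
  change blockDiagHom k hsum _ * _ * blockDiagHom k hsum _ = _
  rw [← map_mul, ← map_mul]
  congr 1
  ext1 b
  exact hT b

end Blocks

section Companion

variable {k : Type*} [Field k]

/-- The polynomial `Q 0 ⋯ Q (b - 1) X ^ i`, where `b` is the block of the position `j` and `i`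
is the position of `j` in this block. -/
noncomputable def blockPoly (s : ℕ) (q : ℕ → ℕ) (Q : ℕ → k[X]) (j : ℕ) : k[X] :=
  (∏ t ∈ range (blockOf q s j), Q t) * X ^ (j - ∑ t ∈ range (blockOf q s j), q t)

lemma blockPoly_sum_add {s : ℕ} {q : ℕ → ℕ} (Q : ℕ → k[X]) {b x : ℕ} (hb : b < s)
    (hx : x < q b) :
    blockPoly s q Q (∑ t ∈ range b, q t + x) = (∏ t ∈ range b, Q t) * X ^ x := by
  simp [blockPoly, blockOf_sum_add q hb hx]

lemma blockPoly_sum {s : ℕ} {q : ℕ → ℕ} (Q : ℕ → k[X]) (hq : ∀ t < s, 0 < q t) {b : ℕ}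
    (hb : b ≤ s) : blockPoly s q Q (∑ t ∈ range b, q t) = ∏ t ∈ range b, Q t := by
  rcases hb.lt_or_eq with hb | rfl
  · simpa using blockPoly_sum_add Q hb (hq b hb)
  · simp [blockPoly, blockOf_of_sum_le]

lemma monic_natDegree_prod {ι : Type*} {q : ι → ℕ} {Q : ι → k[X]} {S : Finset ι}
    (hQ : ∀ t ∈ S, (Q t).Monic ∧ (Q t).natDegree = q t) :
    (∏ t ∈ S, Q t).Monic ∧ (∏ t ∈ S, Q t).natDegree = ∑ t ∈ S, q t :=
  ⟨monic_prod_of_monic _ _ fun t ht => (hQ t ht).1, by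
    rw [natDegree_prod_of_monic _ _ fun t ht => (hQ t ht).1]
    exact sum_congr rfl fun t ht => (hQ t ht).2⟩

lemma monic_natDegree_blockPoly {s : ℕ} {q : ℕ → ℕ} {Q : ℕ → k[X]}
    (hQ : ∀ t < s, (Q t).Monic ∧ (Q t).natDegree = q t) {j : ℕ}
    (hj : j < ∑ t ∈ range s, q t) :
    (blockPoly s q Q j).Monic ∧ (blockPoly s q Q j).natDegree = j := by
  obtain ⟨b, hb, x, hx, rfl⟩ := exists_eq_sum_add q hj
  rw [blockPoly_sum_add Q hb hx]
  obtain ⟨h₁, h₂⟩ := monic_natDegree_prod (S := range b)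
    fun t ht => hQ t ((mem_range.1 ht).trans hb)
  exact ⟨h₁.mul (monic_X_pow x), by rw [h₁.natDegree_mul (monic_X_pow x), h₂, natDegree_X_pow]⟩

/-- In the basis of the polynomials `blockPoly`, multiplication by `X` modulo `∏ Q t` is given by
the generalized companion matrix. -/
lemma sum_genCompanion_mul_blockPoly {s m : ℕ} {q : ℕ → ℕ} {Q : ℕ → k[X]}
    (hq : ∀ t < s, 0 < q t) (hQ : ∀ t < s, (Q t).Monic ∧ (Q t).natDegree = q t)
    (hm : ∑ t ∈ range s, q t = m) (j : Fin m) :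
    ∑ l : Fin m, C (genCompanion s q Q m l j) * blockPoly s q Q l
      = X * blockPoly s q Q j - if (j : ℕ) = m - 1 then ∏ t ∈ range s, Q t else 0 := by
  obtain ⟨j, hj⟩ := j
  obtain ⟨b, hb, x, hx, rfl⟩ := exists_eq_sum_add q (hm ▸ hj)
  simp only [genCompanion, Matrix.of_apply, blockOf_sum_add q hb hx]
  have hoff : ∑ t ∈ range (b + 1), q t = ∑ t ∈ range b, q t + q b := sum_range_succ q b
  have hle : ∑ t ∈ range (b + 1), q t ≤ m :=
    hm ▸ sum_le_sum_of_subset (range_mono (by omega))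
  set off := ∑ t ∈ range b, q t
  have hblock : ∀ y < q b, blockOf q s (off + y) = b := fun y hy => blockOf_sum_add q hb hy
  rw [Fin.sum_univ_eq_sum_range (fun l => C (if blockOf q s l = b ∧ off + x = off + q b - 1
    then -(Q b).coeff (l - off) else if l = off + x + 1 then 1 else 0) * blockPoly s q Q l) m]
  rw [blockPoly_sum_add Q hb hx]
  by_cases hlast : x + 1 = q b
  · have hsplit : ∀ l ∈ range m, C (if blockOf q s l = b ∧ off + x = off + q b - 1
        then -(Q b).coeff (l - off) else if l = off + x + 1 then 1 else 0) * blockPoly s q Q l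
        = (if blockOf q s l = b then C (-(Q b).coeff (l - off)) * blockPoly s q Q l else 0)
          + if l = off + x + 1 then blockPoly s q Q l else 0 := by
      intro l hl
      have hcond : off + x = off + q b - 1 := by omega
      by_cases h₁ : blockOf q s l = b
      · have h₂ : l ≠ off + x + 1 := by
          rintro rfl
          have hlt : off + x + 1 < ∑ t ∈ range s, q t := hm ▸ mem_range.1 hl
          have hbs : b + 1 < s := by
            by_contra hbs
            obtain rfl : s = b + 1 := by omega
            omega
          have := blockOf_sum_add q hbs (hq _ hbs)
          rw [hoff, show off + q b + 0 = off + x + 1 by omega, h₁] at this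
          omega
        rw [if_pos ⟨h₁, hcond⟩, if_pos h₁, if_neg h₂, add_zero]
      · rw [if_neg fun h => h₁ h.1, if_neg h₁, zero_add]
        split_ifs <;> simp
    rw [sum_congr rfl hsplit, sum_add_distrib]
    have hfirst : ∑ l ∈ range m,
        (if blockOf q s l = b then C (-(Q b).coeff (l - off)) * blockPoly s q Q l else 0)
        = -((∏ t ∈ range b, Q t) * ∑ y ∈ range (q b), C ((Q b).coeff y) * X ^ y) := by
      rw [← sum_subset (s₁ := Ico off (off + q b))]
      · rw [sum_Ico_eq_sum_range, Nat.add_sub_cancel_left, mul_sum, ← sum_neg_distrib]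
        refine sum_congr rfl fun y hy => ?_
        have hy := mem_range.1 hy
        rw [if_pos (hblock y hy), blockPoly_sum_add Q hb hy, Nat.add_sub_cancel_left, C_neg]
        ring
      · intro l hl
        simp only [mem_Ico, mem_range] at hl ⊢
        omega
      · intro l hl hl'
        obtain ⟨c, hc, y, hy, rfl⟩ := exists_eq_sum_add q (hm ▸ mem_range.1 hl)
        rw [if_neg]
        rw [blockOf_sum_add q hc hy]
        rintro rfl
        exact hl' (by simp only [mem_Ico]; omega)
    have hsecond : ∑ l ∈ range m, (if l = off + x + 1 then blockPoly s q Q l else 0)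
        = (∏ t ∈ range (b + 1), Q t)
          - if off + x = m - 1 then ∏ t ∈ range s, Q t else 0 := by
      rw [sum_ite_eq', show off + x + 1 = ∑ t ∈ range (b + 1), q t by omega,
        blockPoly_sum Q hq hb]
      by_cases hbs : b + 1 < s
      · have hlt : ∑ t ∈ range (b + 1), q t < m := by
          have h₁ : ∑ t ∈ range (b + 2), q t ≤ m :=
            hm ▸ sum_le_sum_of_subset (range_mono (by omega))
          have h₂ := hq _ hbs
          rw [sum_range_succ] at h₁
          omega
        rw [if_pos (mem_range.2 hlt), if_neg (by omega), sub_zero]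
      · obtain rfl : s = b + 1 := by omega
        rw [if_neg (by simp [hm]), if_pos (by omega), sub_self]
    have hQb := (hQ b hb).1.as_sum
    rw [(hQ b hb).2] at hQb
    rw [hfirst, hsecond, prod_range_succ]
    nth_rewrite 2 [hQb]
    rw [← hlast]
    ring
  · have hcol : ∀ l ∈ range m, C (if blockOf q s l = b ∧ off + x = off + q b - 1
        then -(Q b).coeff (l - off) else if l = off + x + 1 then 1 else 0) * blockPoly s q Q l
        = if l = off + x + 1 then blockPoly s q Q l else 0 := by
      intro l _
      rw [if_neg (by omega)]
      split_ifs <;> simp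
    rw [sum_congr rfl hcol, sum_ite_eq', if_pos (mem_range.2 (by omega)), if_neg (by omega),
      add_assoc, blockPoly_sum_add Q hb (by omega)]
    ring

/-- The companion matrix acts on coefficient vectors as multiplication by `X` modulo `P`. -/
lemma sum_companionMatrix_mul_coeff {m : ℕ} (P f : k[X]) (i : Fin m) :
    ∑ l : Fin m, companionMatrix m P i l * f.coeff l
      = (X * f - C (f.coeff (m - 1)) * P).coeff i := by
  obtain ⟨i, hi⟩ := i
  simp only [companionMatrix, Matrix.of_apply]
  rw [Fin.sum_univ_eq_sum_range (fun l => (if l = m - 1 then -P.coeff i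
    else if i = l + 1 then 1 else 0) * f.coeff l) m]
  obtain ⟨m, rfl⟩ : ∃ m', m = m' + 1 := ⟨m - 1, by omega⟩
  rw [sum_range_succ, coeff_sub, coeff_C_mul, Nat.add_sub_cancel, if_pos rfl]
  have h : ∑ l ∈ range m, (if l = m then -P.coeff i else if i = l + 1 then 1 else 0) * f.coeff l
      = (X * f).coeff i := by
    have h' : ∀ l ∈ range m, (if l = m then -P.coeff i else if i = l + 1 then 1 else 0)
        * f.coeff l = if i = l + 1 then f.coeff l else 0 := by
      intro l hl
      rw [if_neg (mem_range.1 hl).ne]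
      simp
    rw [sum_congr rfl h']
    cases i with
    | zero => simp
    | succ i =>
      simp only [add_left_inj, coeff_X_mul]
      rw [sum_ite_eq, if_pos (mem_range.2 (by omega))]
  rw [h]
  ring

theorem genCompanion_conj_companionMatrix {s m : ℕ} {q : ℕ → ℕ} {Q : ℕ → k[X]}
    (hq : ∀ t < s, 0 < q t) (hQ : ∀ t < s, (Q t).Monic ∧ (Q t).natDegree = q t)
    (hm : ∑ t ∈ range s, q t = m) :
    ∃ T : (Matrix (Fin m) (Fin m) k)ˣ,
      T⁻¹.1 * genCompanion s q Q m * T.1 = companionMatrix m (∏ t ∈ range s, Q t) := by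
  let V : Matrix (Fin m) (Fin m) k := Matrix.of fun i j => (blockPoly s q Q j).coeff i
  have hdeg : ∀ j : Fin m, (blockPoly s q Q j).Monic ∧ (blockPoly s q Q j).natDegree = j :=
    fun j => monic_natDegree_blockPoly hQ (hm ▸ j.2)
  have hone : ∀ j : Fin m, (blockPoly s q Q j).coeff j = 1 := fun j => by
    simpa only [(hdeg j).2] using (hdeg j).1.coeff_natDegree
  have hzero : ∀ (j : Fin m) (i : ℕ), (j : ℕ) < i → (blockPoly s q Q j).coeff i = 0 :=
    fun j i hij => coeff_eq_zero_of_natDegree_lt ((hdeg j).2.symm ▸ hij)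
  have hdet : V.det = 1 := by
    have htri : V.IsUpperTriangular := fun i j hij => hzero j i hij
    rw [Matrix.det_of_isUpperTriangular htri]
    exact prod_eq_one fun j _ => hone j
  have hV : V * genCompanion s q Q m = companionMatrix m (∏ t ∈ range s, Q t) * V := by
    ext i j
    have hleft : (V * genCompanion s q Q m) i j
        = (∑ l : Fin m, C (genCompanion s q Q m l j) * blockPoly s q Q l).coeff i := by
      simp [Matrix.mul_apply, V, mul_comm]
    rw [hleft, sum_genCompanion_mul_blockPoly hq hQ hm, Matrix.mul_apply]
    simp only [V, Matrix.of_apply]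
    rw [sum_companionMatrix_mul_coeff]
    congr 2
    split_ifs with h
    · rw [← h, hone, C_1, one_mul]
    · rw [hzero j _ (by omega), C_0, zero_mul]
  obtain ⟨U, hU⟩ := (Matrix.isUnit_iff_isUnit_det V).2 (hdet ▸ isUnit_one)
  refine ⟨U⁻¹, ?_⟩
  rw [inv_inv, hU, hV, ← hU, mul_assoc, Units.mul_inv, mul_one]

end Companion

section Jumps

variable {r s : ℕ} {p jj : ℕ → ℕ}

lemma kOf_jump (hjmono : ∀ a b, a < b → b < s - 1 → jj a < jj b) {t : ℕ} (ht : t < s - 1) :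
    kOf jj s (jj t) = t ∧ kOf jj s (jj t + 1) = t + 1 := by
  have hlt : ∀ u < s - 1, (jj u < jj t ↔ u < t) ∧ (jj u < jj t + 1 ↔ u < t + 1) := by
    intro u hu
    rcases lt_trichotomy u t with h | rfl | h
    · have := hjmono u t h ht; omega
    · omega
    · have := hjmono t u h hu; omega
  have h₁ : ((range (s - 1)).filter fun u => jj u < jj t) = range t := by
    ext u
    simp only [mem_filter, mem_range]
    exact ⟨fun h => ((hlt u h.1).1).1 h.2, fun h => ⟨by omega, ((hlt u (by omega)).1).2 h⟩⟩
  have h₂ : ((range (s - 1)).filter fun u => jj u < jj t + 1) = range (t + 1) := by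
    ext u
    simp only [mem_filter, mem_range]
    exact ⟨fun h => ((hlt u h.1).2).1 h.2, fun h => ⟨by omega, ((hlt u (by omega)).2).2 h⟩⟩
  simp only [kOf, h₁, h₂, card_range, and_self]

lemma kOf_last (hjchar : ∀ i, (i + 1 < r ∧ p i ≠ p (i + 1)) ↔ ∃ t < s - 1, jj t = i) :
    kOf jj s (r - 1) = s - 1 := by
  rw [kOf, filter_true_of_mem, card_range]
  intro t ht
  have := ((hjchar (jj t)).2 ⟨t, mem_range.1 ht, rfl⟩).1
  omega

lemma kOf_succ_of_eq (hjchar : ∀ i, (i + 1 < r ∧ p i ≠ p (i + 1)) ↔ ∃ t < s - 1, jj t = i)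
    {i : ℕ} (hi : p i = p (i + 1)) : kOf jj s i = kOf jj s (i + 1) := by
  rw [kOf, kOf]
  congr 1
  refine filter_congr fun t ht => ?_
  have : jj t ≠ i := fun h => ((hjchar i).2 ⟨t, mem_range.1 ht, h⟩).2 hi
  omega

lemma kOf_lt (hs : 1 ≤ s) (i : ℕ) : kOf jj s i < s := by
  have : kOf jj s i ≤ s - 1 := (card_filter_le _ _).trans_eq (card_range _)
  omega

/-- A family `F` on the blocks that is multiplied by `G t` at the `t`-th jump, and is constant
elsewhere, is given by the products of the tails of `G`. -/
lemma eq_prod_Ico_kOf {M : Type*} [CommMonoid M] {F G : ℕ → M} (hs : 1 ≤ s)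
    (hjmono : ∀ a b, a < b → b < s - 1 → jj a < jj b)
    (hjchar : ∀ i, (i + 1 < r ∧ p i ≠ p (i + 1)) ↔ ∃ t < s - 1, jj t = i)
    (hlast : F (r - 1) = G (s - 1))
    (hconst : ∀ i, i + 1 < r → p i = p (i + 1) → F i = F (i + 1))
    (hjump : ∀ t < s - 1, F (jj t) = G t * F (jj t + 1)) {i : ℕ} (hi : i < r) :
    F i = ∏ t ∈ Ico (kOf jj s i) s, G t := by
  refine Nat.decreasingInduction' (P := fun i => F i = ∏ t ∈ Ico (kOf jj s i) s, G t)
    (n := r - 1) (fun i hir _ ih => ?_) (Nat.le_sub_one_of_lt hi) ?_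
  · by_cases hp : p i = p (i + 1)
    · rw [hconst i (by omega) hp, ih, kOf_succ_of_eq hjchar hp]
    · obtain ⟨t, ht, rfl⟩ := (hjchar i).1 ⟨by omega, hp⟩
      rw [hjump t ht, ih, (kOf_jump hjmono ht).1, (kOf_jump hjmono ht).2,
        ← prod_eq_prod_Ico_succ_bot (by omega)]
  · rw [hlast, kOf_last hjchar, prod_eq_prod_Ico_succ_bot (by omega)]
    simp [Nat.sub_add_cancel hs]

end Jumps

/-- everything 0-indexed: let `p 0 ≥ p 1 ≥ … ≥ p (r-1) ≥ 1` be a partition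
of `n` with `s` distinct parts, `jj 0 < … < jj (s-2)` its jump indices, `jj (s-1) = r-1`,
`q t = p (jj t) - p (jj t + 1)` for `t < s-1` and `q (s-1) = p (r-1)`.  For monic
polynomials `Q t` of degree `q t` let `A(Q)` be the block diagonal matrix with `r` blocks
`D i = C(Q k(i), …, Q (s-1))`.  Then
(a) `A(Q)` is similar to the rational normal form `R(P 0, …, P (r-1))` with
    `P i = Q k(i) ⋯ Q (s-1)`, which lies in `R(p)`; and
(b) `(Q 0, …, Q (s-1)) ↦ (P 0, …, P (r-1))` is a bijection onto the tuples of monic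
    polynomials with `deg (P i) = p i` and `P (i+1) ∣ P i`. -/
theorem stmt5 {k : Type*} [Field k] (n r s : ℕ) (hr : 1 ≤ r) (hs : 1 ≤ s)
    (p : ℕ → ℕ) (hpmono : ∀ i, i + 1 < r → p (i + 1) ≤ p i) (hppos : ∀ i < r, 1 ≤ p i)
    (hsum : ∑ i ∈ Finset.range r, p i = n)
    (jj : ℕ → ℕ) (hjmono : ∀ a b, a < b → b < s - 1 → jj a < jj b)
    (hjchar : ∀ i, (i + 1 < r ∧ p i ≠ p (i + 1)) ↔ ∃ t < s - 1, jj t = i)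
    (hjlast : jj (s - 1) = r - 1)
    (q : ℕ → ℕ) (hqdef : ∀ t < s - 1, q t = p (jj t) - p (jj t + 1))
    (hqlast : q (s - 1) = p (r - 1))
    (Q : ℕ → Polynomial k) (hQ : ∀ t < s, (Q t).Monic ∧ (Q t).natDegree = q t)
    (P : ℕ → Polynomial k) (hP : ∀ i, P i = ∏ t ∈ Finset.Ico (kOf jj s i) s, Q t)
    (AQ : Matrix (Fin n) (Fin n) k)
    (hAQ : AQ = blockDiagMat r p
      (fun b => genCompanion (s - kOf jj s b) (fun t => q (kOf jj s b + t))
        (fun t => Q (kOf jj s b + t)) (p b)) n) :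
    -- (a)
    ((∀ i < r, (P i).Monic ∧ (P i).natDegree = p i) ∧
      (∀ i, i + 1 < r → P (i + 1) ∣ P i) ∧
      ∃ T : (Matrix (Fin n) (Fin n) k)ˣ,
        (↑T⁻¹ : Matrix (Fin n) (Fin n) k) * AQ * (↑T : Matrix (Fin n) (Fin n) k) =
          ratNormalForm r p P n) ∧
    -- (b) surjectivity
    ((∀ P' : ℕ → Polynomial k,
        (∀ i < r, (P' i).Monic ∧ (P' i).natDegree = p i) →
        (∀ i, i + 1 < r → P' (i + 1) ∣ P' i) →
        ∃ Q' : ℕ → Polynomial k, (∀ t < s, (Q' t).Monic ∧ (Q' t).natDegree = q t) ∧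
          ∀ i < r, P' i = ∏ t ∈ Finset.Ico (kOf jj s i) s, Q' t) ∧
    -- (b) injectivity
      (∀ Q₁ Q₂ : ℕ → Polynomial k,
        (∀ t < s, (Q₁ t).Monic ∧ (Q₁ t).natDegree = q t) →
        (∀ t < s, (Q₂ t).Monic ∧ (Q₂ t).natDegree = q t) →
        (∀ i < r, (∏ t ∈ Finset.Ico (kOf jj s i) s, Q₁ t) =
          ∏ t ∈ Finset.Ico (kOf jj s i) s, Q₂ t) →
        ∀ t < s, Q₁ t = Q₂ t)) := by
  have hjr : ∀ t < s - 1, jj t + 1 < r ∧ p (jj t) ≠ p (jj t + 1) :=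
    fun t ht => (hjchar _).2 ⟨t, ht, rfl⟩
  have hsplit : ∀ t < s - 1, p (jj t) = q t + p (jj t + 1) := fun t ht => by
    have := hpmono _ (hjr t ht).1
    rw [hqdef t ht]
    omega
  have hqpos : ∀ t < s, 0 < q t := fun t ht => by
    rcases (Nat.le_sub_one_of_lt ht).lt_or_eq with h | rfl
    · have := hsplit t h
      have := (hjr t h).2
      omega
    · exact hqlast ▸ hppos _ (by omega)
  have hpsum : ∀ i < r, ∑ t ∈ Finset.Ico (kOf jj s i) s, q t = p i := fun i hi =>
    (eq_prod_Ico_kOf (M := Multiplicative ℕ) (F := p) (G := q) hs hjmono hjchar hqlast.symm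
      (fun _ _ h => h) hsplit hi).symm
  have hPdeg : ∀ i < r, (P i).Monic ∧ (P i).natDegree = p i := fun i hi => by
    rw [hP i, ← hpsum i hi]
    exact monic_natDegree_prod fun t ht => hQ t (Finset.mem_Ico.1 ht).2
  refine ⟨⟨hPdeg, fun i _ => ?_, ?_⟩, fun P' hP' hdvd => ?_, fun Q₁ Q₂ hQ₁ hQ₂ heq => ?_⟩
  · rw [hP, hP]
    refine Finset.prod_dvd_prod_of_subset _ _ _ (Finset.Ico_subset_Ico_left ?_)
    exact Finset.card_le_card
      (Finset.monotone_filter_right _ fun t _ (ht : jj t < i) => Nat.lt_succ_of_lt ht)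
  · rw [hAQ, blockDiagMat_eq hsum, ratNormalForm_eq hsum]
    refine exists_conj_blockDiagHom hsum _ _ fun b => ?_
    have hlt : ∀ t < s - kOf jj s b, kOf jj s b + t < s := fun t ht => by omega
    rw [hP, Finset.prod_Ico_eq_prod_range]
    refine genCompanion_conj_companionMatrix (fun t ht => hqpos _ (hlt t ht))
      (fun t ht => hQ _ (hlt t ht)) ?_
    rw [← hpsum b b.2, Finset.sum_Ico_eq_sum_range]
  · have hmul : ∀ t < s - 1,
        P' (jj t) = P' (jj t) /ₘ P' (jj t + 1) * P' (jj t + 1) := fun t ht => by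
      obtain ⟨c, hc⟩ := hdvd _ (hjr t ht).1
      rw [hc, Polynomial.mul_divByMonic_cancel_left _ (hP' _ (hjr t ht).1).1, mul_comm]
    refine ⟨fun t => if t < s - 1 then P' (jj t) /ₘ P' (jj t + 1) else P' (r - 1),
      fun t ht => ?_, fun i hi => ?_⟩
    · dsimp only
      split_ifs with h
      · obtain ⟨h₁, h₁'⟩ := hP' (jj t) (by have := (hjr t h).1; omega)
        obtain ⟨h₂, h₂'⟩ := hP' (jj t + 1) (hjr t h).1
        refine ⟨h₂.of_mul_monic_right (hmul t h ▸ h₁), ?_⟩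
        rw [Polynomial.natDegree_divByMonic _ h₂, h₁', h₂', hqdef t h]
      · obtain rfl : t = s - 1 := by omega
        exact hqlast ▸ hP' _ (by omega)
    · refine eq_prod_Ico_kOf (G := fun t => if t < s - 1 then P' (jj t) /ₘ P' (jj t + 1)
        else P' (r - 1)) hs hjmono hjchar (by simp) (fun i hi hpi => ?_) (fun t ht => ?_) hi
      · obtain ⟨h₁, h₁'⟩ := hP' i (by omega)
        obtain ⟨h₂, h₂'⟩ := hP' (i + 1) hi
        exact (Polynomial.eq_of_dvd_of_natDegree_le_of_leadingCoeff (hdvd i hi) (by omega)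
          (by rw [h₁, h₂])).symm
      · simpa only [if_pos ht] using hmul t ht
  · have htail : ∀ t ≤ s, ∏ u ∈ Finset.Ico t s, Q₁ u = ∏ u ∈ Finset.Ico t s, Q₂ u := by
      intro t ht
      rcases ht.lt_or_eq with ht | rfl
      · rcases (Nat.le_sub_one_of_lt ht).lt_or_eq with h | rfl
        · have := heq (jj t) (by have := (hjr t h).1; omega)
          rwa [(kOf_jump hjmono h).1] at this
        · have := heq (r - 1) (by omega)
          rwa [kOf_last hjchar] at this
      · simp
    intro t ht
    have h := htail t ht.le
    rw [Finset.prod_eq_prod_Ico_succ_bot ht, Finset.prod_eq_prod_Ico_succ_bot ht,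
      htail (t + 1) ht] at h
    refine mul_right_cancel₀ (Polynomial.Monic.ne_zero ?_) h
    exact (monic_natDegree_prod fun u hu => hQ₂ u (Finset.mem_Ico.1 hu).2).1
end
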